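/- Fix N ∈ ℕ, reals p_1,…,p_N > 0, a_1,…,a_N, r_1,…,r_N ∈ ℝ, and nonzero reals α, β with p_j α ≠ ±1 and p_j β ≠ ±1 for all j. For l, k ∈ ℤ and (y_0, y_2) ∈ ℝ² define the semi-discrete N-soliton tau function τ(l, k; y_0, y_2) = Σ_{S ⊆ {1,…,N}} [ Π_{i<j, i,j∈S} ((p_i − p_j)/(p_i + p_j))² ] · Π_{j∈S} φ_j(l, k; y_0, y_2), where φ_j(l, k; y_0, y_2) = a_j exp(r_j y_0 + r_j p_j² y_2) ((1 + p_j α)/(1 − p_j α))^l ((1 + p_j β)/(1 − p_j β))^k. Then for all l, k ∈ ℤ and all (y_0, y_2) ∈ ℝ²: αβ² D_{y_2}( 2α τ(l+1,k)·τ(l,k) − (α+β) τ(l,k+1)·τ(l+1,k−1) − (α−β) τ(l,k−1)·τ(l+1,k+1) ) = D_{y_0}( 2(2β² − α²) τ(l+1,k)·τ(l,k) − α(α+β) τ(l,k+1)·τ(l+1,k−1) − α(α−β) τ(l,k−1)·τ(l+1,k+1) ), where all tau functions are evaluated at the same (y_0, y_2). -/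

import Mathlib

noncomputable section

/-- Hirota bilinear operator in `y₀`: `D_{y₀} f·g = (∂_{y₀}f) g − f (∂_{y₀}g)`. -/
def Dy0 (f g : ℝ → ℝ → ℝ) (y0 y2 : ℝ) : ℝ :=
  deriv (fun s => f s y2) y0 * g y0 y2 - f y0 y2 * deriv (fun s => g s y2) y0

/-- Hirota bilinear operator in `y₂`: `D_{y₂} f·g = (∂_{y₂}f) g − f (∂_{y₂}g)`. -/
def Dy2 (f g : ℝ → ℝ → ℝ) (y0 y2 : ℝ) : ℝ :=
  deriv (fun s => f y0 s) y2 * g y0 y2 - f y0 y2 * deriv (fun s => g y0 s) y2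

/-- The one-soliton factor `φ_j(l, k; y₀, y₂)` of the semi-discrete tau function. -/
def phiS {N : ℕ} (p a r : Fin N → ℝ) (α β : ℝ) (j : Fin N) (l k : ℤ) (y0 y2 : ℝ) : ℝ :=
  a j * Real.exp (r j * y0 + r j * (p j) ^ 2 * y2) *
    ((1 + p j * α) / (1 - p j * α)) ^ l * ((1 + p j * β) / (1 - p j * β)) ^ k

/-- The semi-discrete `N`-soliton tau function. -/
def tauS {N : ℕ} (p a r : Fin N → ℝ) (α β : ℝ) (l k : ℤ) (y0 y2 : ℝ) : ℝ :=
  ∑ S : Finset (Fin N),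
    (∏ i ∈ S, ∏ j ∈ S.filter (fun j => i < j), ((p i - p j) / (p i + p j)) ^ 2) *
      ∏ j ∈ S, phiS p a r α β j l k y0 y2

/-- For `L = [p₁, …, pₙ]`, the sum over all signs `kᵢ = ± pᵢ` of
`∏_{i<j} (kᵢ - kⱼ)² ∏ᵢ w kᵢ`, defined by recursion on the list. -/
def signSum : List ℝ → (ℝ → ℝ) → ℝ
  | [], _ => 1
  | p :: L, w =>
      w p * signSum L (fun k => w k * (k - p) ^ 2) +
        w (-p) * signSum L (fun k => w k * (k + p) ^ 2)

lemma signSum_neg (L : List ℝ) (w : ℝ → ℝ) :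
    signSum L (fun k => w (-k)) = signSum L w := by
  induction L generalizing w with
  | nil => rfl
  | cons p L ih =>
    have h1 := ih (fun k => w k * (k - p) ^ 2)
    have h2 := ih (fun k => w k * (k + p) ^ 2)
    simp only [signSum, neg_neg]
    rw [← h1, ← h2, add_comm]
    congr 3 <;> funext k <;> ring

lemma signSum_even_mul (L : List ℝ) (e w : ℝ → ℝ) (he : ∀ k, e (-k) = e k) :
    signSum L (fun k => e k * w k) = (L.map e).prod * signSum L w := by
  induction L generalizing w with
  | nil => simp [signSum]
  | cons p L ih =>
    simp only [signSum, mul_assoc, ih, he, List.map_cons, List.prod_cons]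
    ring

lemma signSum_of_eq_even_mul (L : List ℝ) (v e w : ℝ → ℝ) (he : ∀ k, e (-k) = e k)
    (h : ∀ k, v k = e k * w k) : signSum L v = (L.map e).prod * signSum L w := by
  rw [← signSum_even_mul L e w he]
  exact congrArg _ (funext h)

lemma signSum_of_eq_even_mul_neg (L : List ℝ) (v e w : ℝ → ℝ) (he : ∀ k, e (-k) = e k)
    (h : ∀ k, v k = e k * w (-k)) : signSum L v = (L.map e).prod * signSum L w := by
  rw [← signSum_neg L w]
  exact signSum_of_eq_even_mul L v e _ he h

lemma signSum_perm {L L' : List ℝ} (h : L.Perm L') (w : ℝ → ℝ) :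
    signSum L w = signSum L' w := by
  induction h generalizing w with
  | nil => rfl
  | cons p _ ih => simp only [signSum, ih]
  | swap p q L =>
    simp only [signSum]
    have e1 : (fun k => w k * (k - q) ^ 2 * (k - p) ^ 2) =
        fun k => w k * (k - p) ^ 2 * (k - q) ^ 2 := by funext k; ring
    have e2 : (fun k => w k * (k - q) ^ 2 * (k + p) ^ 2) =
        fun k => w k * (k + p) ^ 2 * (k - q) ^ 2 := by funext k; ring
    have e3 : (fun k => w k * (k + q) ^ 2 * (k - p) ^ 2) =
        fun k => w k * (k - p) ^ 2 * (k + q) ^ 2 := by funext k; ring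
    have e4 : (fun k => w k * (k + q) ^ 2 * (k + p) ^ 2) =
        fun k => w k * (k + p) ^ 2 * (k + q) ^ 2 := by funext k; ring
    rw [e1, e2, e3, e4]
    ring
  | trans _ _ ih1 ih2 => rw [ih1, ih2]

lemma signSum_cons_mul_sub_sq (p : ℝ) (L : List ℝ) (w : ℝ → ℝ) :
    signSum (p :: L) (fun k => w k * (k - p) ^ 2) =
      4 * p ^ 2 * w (-p) * (L.map fun q => (q ^ 2 - p ^ 2) ^ 2).prod * signSum L w := by
  have h := signSum_of_eq_even_mul L (fun k => w k * (k - p) ^ 2 * (k + p) ^ 2)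
    (fun q => (q ^ 2 - p ^ 2) ^ 2) w (fun k => by ring) (fun k => by ring)
  simp only [signSum, h]
  ring

lemma signSum_cons_mul_add_sq (p : ℝ) (L : List ℝ) (w : ℝ → ℝ) :
    signSum (p :: L) (fun k => w k * (k + p) ^ 2) =
      4 * p ^ 2 * w p * (L.map fun q => (q ^ 2 - p ^ 2) ^ 2).prod * signSum L w := by
  have h := signSum_of_eq_even_mul L (fun k => w k * (k + p) ^ 2 * (k - p) ^ 2)
    (fun q => (q ^ 2 - p ^ 2) ^ 2) w (fun k => by ring) (fun k => by ring)
  simp only [signSum, h]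
  ring

lemma signSum_cons_cons_self (p : ℝ) (L : List ℝ) (w : ℝ → ℝ) :
    signSum (p :: p :: L) w =
      8 * p ^ 2 * (w p * w (-p)) * (L.map fun q => (q ^ 2 - p ^ 2) ^ 2).prod *
        signSum L w := by
  rw [signSum, signSum_cons_mul_sub_sq, signSum_cons_mul_add_sq]
  ring

lemma exists_polynomial_signSum (L : List ℝ) (w : ℝ → ℝ) :
    ∃ P : Polynomial ℝ, P.natDegree ≤ 2 * L.length ∧
      ∀ z, P.eval z = signSum L (fun k => w k * (k - z) ^ 2) := by
  induction L generalizing w with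
  | nil => exact ⟨1, by simp, by simp [signSum]⟩
  | cons p L ih =>
    obtain ⟨P, hP, hPe⟩ := ih (fun k => w k * (k - p) ^ 2)
    obtain ⟨Q, hQ, hQe⟩ := ih (fun k => w k * (k + p) ^ 2)
    refine ⟨.C (w p) * (.C p - .X) ^ 2 * P + .C (w (-p)) * (.C p + .X) ^ 2 * Q, ?_, ?_⟩
    · rw [List.length_cons]
      have h1 : (Polynomial.C (w p) * (Polynomial.C p - Polynomial.X) ^ 2).natDegree ≤ 2 := by
        compute_degree
      have h2 : (Polynomial.C (w (-p)) * (Polynomial.C p + Polynomial.X) ^ 2).natDegree ≤ 2 := by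
        compute_degree
      have h3 := Polynomial.natDegree_mul_le_of_le h1 hP
      have h4 := Polynomial.natDegree_mul_le_of_le h2 hQ
      exact Polynomial.natDegree_add_le_of_degree_le (h3.trans (by omega)) (h4.trans (by omega))
    · intro z
      have e1 : (fun k => w k * (k - z) ^ 2 * (k - p) ^ 2) =
          fun k => w k * (k - p) ^ 2 * (k - z) ^ 2 := by funext k; ring
      have e2 : (fun k => w k * (k - z) ^ 2 * (k + p) ^ 2) =
          fun k => w k * (k + p) ^ 2 * (k - z) ^ 2 := by funext k; ring
      simp only [signSum, e1, e2, ← hPe, ← hQe, Polynomial.eval_add, Polynomial.eval_mul,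
        Polynomial.eval_pow, Polynomial.eval_sub, Polynomial.eval_C, Polynomial.eval_X]
      ring

lemma exists_polynomial_mul_signSum (L : List ℝ) (w : ℝ → ℝ) (R : Polynomial ℝ)
    (hR : R.natDegree ≤ 3) :
    ∃ P : Polynomial ℝ, P.natDegree ≤ 2 * L.length + 3 ∧
      ∀ z, P.eval z = R.eval z * signSum L (fun k => w k * (k - z) ^ 2) := by
  obtain ⟨P, hP, hPe⟩ := exists_polynomial_signSum L w
  exact ⟨R * P, (Polynomial.natDegree_mul_le_of_le hR hP).trans (by omega),
    fun z => by rw [Polynomial.eval_mul, hPe]⟩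

lemma Polynomial.eq_zero_of_eval_pm_eq_zero (P : Polynomial ℝ) (Z : List ℝ) (hZ : Z.Nodup)
    (hpos : ∀ z ∈ Z, 0 < z) (hroot : ∀ z ∈ Z, P.eval z = 0 ∧ P.eval (-z) = 0)
    (hdeg : P.natDegree < 2 * Z.length) : P = 0 := by
  classical
  have hc : Z.toFinset.card = Z.length := List.toFinset_card_of_nodup hZ
  have hd : Disjoint Z.toFinset (Z.toFinset.image Neg.neg) := by
    rw [Finset.disjoint_left]
    intro z hz hz'
    simp only [Finset.mem_image, List.mem_toFinset] at hz hz'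
    obtain ⟨y, hy, rfl⟩ := hz'
    linarith [hpos _ hz, hpos _ hy]
  refine Polynomial.eq_zero_of_natDegree_lt_card_of_eval_eq_zero' P
    (Z.toFinset ∪ Z.toFinset.image Neg.neg) ?_ ?_
  · intro z hz
    simp only [Finset.mem_union, Finset.mem_image, List.mem_toFinset] at hz
    rcases hz with hz | ⟨y, hy, rfl⟩
    · exact (hroot z hz).1
    · exact (hroot y hy).2
  · rw [Finset.card_union_of_disjoint hd, Finset.card_image_of_injective _ neg_injective, hc]
    omega

/-- A polynomial of degree at most `2 |L| + 3` vanishing at `± p` for `p ∈ L`, at `± α⁻¹` and at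
`± β⁻¹` is zero. -/
lemma Polynomial.eq_zero_of_soliton_roots (P : Polynomial ℝ) (L : List ℝ) (α β : ℝ)
    (hα : α ≠ 0) (hβ : β ≠ 0) (hαβ : α ^ 2 ≠ β ^ 2) (hL : L.Nodup)
    (hpos : ∀ p ∈ L, 0 < p) (hLα : ∀ p ∈ L, p * α ≠ 1 ∧ p * α ≠ -1)
    (hLβ : ∀ p ∈ L, p * β ≠ 1 ∧ p * β ≠ -1) (hdeg : P.natDegree ≤ 2 * L.length + 3)
    (hsymm : ∀ z, P.eval z = 0 → P.eval (-z) = 0)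
    (hPα : P.eval α⁻¹ = 0) (hPβ : P.eval β⁻¹ = 0) (hPL : ∀ p ∈ L, P.eval p = 0) : P = 0 := by
  have key : ∀ γ : ℝ, γ ≠ 0 → (∀ p ∈ L, p * γ ≠ 1 ∧ p * γ ≠ -1) → |γ|⁻¹ ∉ L := by
    intro γ hγ h hm
    have h1 := h _ hm
    rcases abs_choice γ with hg | hg <;> rw [hg] at h1
    · exact h1.1 (inv_mul_cancel₀ hγ)
    · exact h1.2 (by field_simp)
  have root : ∀ γ : ℝ, P.eval γ⁻¹ = 0 → P.eval |γ|⁻¹ = 0 := by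
    intro γ h
    rcases abs_choice γ with hg | hg <;> rw [hg]
    · exact h
    · rw [inv_neg]; exact hsymm _ h
  refine P.eq_zero_of_eval_pm_eq_zero (|α|⁻¹ :: |β|⁻¹ :: L) ?_ ?_ ?_ ?_
  · rw [List.nodup_cons, List.nodup_cons, List.mem_cons, not_or]
    refine ⟨⟨fun h => hαβ ?_, key α hα hLα⟩, key β hβ hLβ, hL⟩
    exact sq_eq_sq_iff_abs_eq_abs α β |>.2 (inv_injective h)
  · simp only [List.mem_cons, forall_eq_or_imp, inv_pos, abs_pos]
    exact ⟨hα, hβ, hpos⟩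
  · have h0 : ∀ z ∈ |α|⁻¹ :: |β|⁻¹ :: L, P.eval z = 0 := by
      simp only [List.mem_cons, forall_eq_or_imp]
      exact ⟨root α hPα, root β hPβ, hPL⟩
    exact fun z hz => ⟨h0 z hz, hsymm z (h0 z hz)⟩
  · simp only [List.length_cons]; omega

lemma List.exists_perm_cons_cons_of_not_nodup {ι : Type*} {L : List ι} (h : ¬ L.Nodup) :
    ∃ p L', L.Perm (p :: p :: L') := by
  obtain ⟨p, hp⟩ := List.exists_duplicate_iff_not_nodup.2 h
  obtain ⟨L', hL'⟩ := (List.duplicate_iff_sublist.1 hp).exists_perm_append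
  exact ⟨p, L', hL'⟩

/-- The weight of the pair of shifts `(1, 0), (0, 0)`. -/
def weightA (α β k : ℝ) : ℝ := (1 + α * k) * (1 - β ^ 2 * k ^ 2)

/-- The weight of the pair of shifts `(0, 1), (1, -1)`; replacing `β` by `-β` gives the weight of
the pair `(0, -1), (1, 1)`. -/
def weightB (α β k : ℝ) : ℝ := (1 - α * k) * (1 + β * k) ^ 2

lemma signSum_discreteKdV (α β : ℝ) (hα : α ≠ 0) (hβ : β ≠ 0) (L : List ℝ)
    (hpos : ∀ p ∈ L, 0 < p) (hLα : ∀ p ∈ L, p * α ≠ 1 ∧ p * α ≠ -1)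
    (hLβ : ∀ p ∈ L, p * β ≠ 1 ∧ p * β ≠ -1) :
    2 * α * signSum L (weightA α β) - (α + β) * signSum L (weightB α β) -
      (α - β) * signSum L (weightB α (-β)) = 0 := by
  by_cases hαβ : α ^ 2 = β ^ 2
  · rcases sq_eq_sq_iff_eq_or_eq_neg.1 hαβ with rfl | rfl
    · have : weightA α α = weightB α α := by funext k; simp only [weightA, weightB]; ring
      rw [this]; ring
    · have : weightA (-β) β = weightB (-β) (-β) := by
        funext k; simp only [weightA, weightB]; ring
      rw [this]; ring
  induction hn : L.length using Nat.strong_induction_on generalizing L with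
  | _ n ih =>
  by_cases hL : L.Nodup
  swap
  · obtain ⟨p, L', hp⟩ := List.exists_perm_cons_cons_of_not_nodup hL
    have hm : ∀ q ∈ L', q ∈ L := fun q hq => hp.mem_iff.2 (by simp [hq])
    have := ih L'.length (by have := hp.length_eq; simp at this; omega) L'
      (fun q hq => hpos q (hm q hq)) (fun q hq => hLα q (hm q hq))
      (fun q hq => hLβ q (hm q hq)) rfl
    simp only [signSum_perm hp, signSum_cons_cons_self]
    simp only [weightA, weightB] at this ⊢
    linear_combination
      (8 * p ^ 2 * ((1 - α ^ 2 * p ^ 2) * (1 - β ^ 2 * p ^ 2) ^ 2) *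
        (L'.map fun q => (q ^ 2 - p ^ 2) ^ 2).prod) * this
  rcases L with _ | ⟨z, L⟩
  · simp only [signSum]; ring
  simp only [List.mem_cons, forall_eq_or_imp] at hpos hLα hLβ
  simp only [List.length_cons] at hn
  have hE := ih L.length (by omega) L hpos.2 hLα.2 hLβ.2 rfl
  obtain ⟨PA, hA, hAe⟩ := exists_polynomial_mul_signSum L (weightA α β)
    ((1 + .C α * .X) * (1 - .C (β ^ 2) * .X ^ 2)) (by compute_degree)
  obtain ⟨PB, hB, hBe⟩ := exists_polynomial_mul_signSum L (weightB α β)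
    ((1 - .C α * .X) * (1 + .C β * .X) ^ 2) (by compute_degree)
  obtain ⟨PC, hC, hCe⟩ := exists_polynomial_mul_signSum L (weightB α (-β))
    ((1 - .C α * .X) * (1 + .C (-β) * .X) ^ 2) (by compute_degree)
  let P : Polynomial ℝ := .C (2 * α) * PA - .C (α + β) * PB - .C (α - β) * PC
  have hdP : P.natDegree ≤ 2 * L.length + 3 := by
    refine (Polynomial.natDegree_sub_le_iff_left ?_).2
      ((Polynomial.natDegree_sub_le_iff_left ?_).2 ?_) <;>
    exact (Polynomial.natDegree_C_mul_le _ _).trans ‹_›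
  have hPe : ∀ z, (P + P.comp (-.X)).eval z =
      2 * α * signSum (z :: L) (weightA α β) - (α + β) * signSum (z :: L) (weightB α β) -
      (α - β) * signSum (z :: L) (weightB α (-β)) := by
    intro z
    simp only [P, Polynomial.eval_add, Polynomial.eval_sub, Polynomial.eval_mul,
      Polynomial.eval_comp, Polynomial.eval_C, Polynomial.eval_neg, Polynomial.eval_X, hAe, hBe,
      hCe, signSum, sub_neg_eq_add, Polynomial.eval_one, Polynomial.eval_pow]
    simp only [weightA, weightB]
    ring
  have hP0 : P + P.comp (-.X) = 0 := by
    refine Polynomial.eq_zero_of_soliton_roots _ L α β hα hβ hαβ (List.nodup_cons.1 hL).2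
      hpos.2 hLα.2 hLβ.2 ?_ ?_ ?_ ?_ ?_
    · refine Polynomial.natDegree_add_le_of_degree_le hdP ?_
      rw [Polynomial.natDegree_comp]
      simpa using hdP
    · intro z hz
      simp only [Polynomial.eval_add, Polynomial.eval_comp, Polynomial.eval_neg,
        Polynomial.eval_X, neg_neg] at hz ⊢
      linarith
    · rw [hPe]
      have hA := signSum_of_eq_even_mul_neg L (fun k => weightA α β k * (k - α⁻¹) ^ 2)
        (fun k => (1 - α ^ 2 * k ^ 2) / α ^ 2) (weightA α β) (fun k => by ring)
        (fun k => by simp only [weightA]; field_simp; ring)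
      have hB := signSum_of_eq_even_mul_neg L (fun k => weightB α β k * (k + α⁻¹) ^ 2)
        (fun k => (1 - α ^ 2 * k ^ 2) / α ^ 2) (weightB α (-β)) (fun k => by ring)
        (fun k => by simp only [weightB]; field_simp; ring)
      have hC := signSum_of_eq_even_mul_neg L (fun k => weightB α (-β) k * (k + α⁻¹) ^ 2)
        (fun k => (1 - α ^ 2 * k ^ 2) / α ^ 2) (weightB α β) (fun k => by ring)
        (fun k => by simp only [weightB]; field_simp; ring)
      have vA : weightA α β (-α⁻¹) = 0 := by simp only [weightA]; field_simp; ring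
      have vB : weightB α β α⁻¹ = 0 := by simp only [weightB]; field_simp; ring
      have vC : weightB α (-β) α⁻¹ = 0 := by simp only [weightB]; field_simp; ring
      have uA : weightA α β α⁻¹ = 2 * (α ^ 2 - β ^ 2) / α ^ 2 := by
        simp only [weightA]; field_simp; ring
      have uB : weightB α β (-α⁻¹) = 2 * (α - β) ^ 2 / α ^ 2 := by
        simp only [weightB]; field_simp; ring
      have uC : weightB α (-β) (-α⁻¹) = 2 * (α + β) ^ 2 / α ^ 2 := by
        simp only [weightB]; field_simp; ring
      simp only [signSum, hA, hB, hC, vA, vB, vC, uA, uB, uC]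
      linear_combination (2 * (α ^ 2 - β ^ 2) / α ^ 2 *
        (L.map fun k => (1 - α ^ 2 * k ^ 2) / α ^ 2).prod) * hE
    · rw [hPe]
      have hB := signSum_of_eq_even_mul L (fun k => weightB α β k * (k - β⁻¹) ^ 2)
        (fun k => (1 - β ^ 2 * k ^ 2) ^ 2 / β ^ 2) (fun k => 1 - α * k) (fun k => by ring)
        (fun k => by simp only [weightB]; field_simp; ring)
      have hC := signSum_of_eq_even_mul L (fun k => weightB α (-β) k * (k + β⁻¹) ^ 2)
        (fun k => (1 - β ^ 2 * k ^ 2) ^ 2 / β ^ 2) (fun k => 1 - α * k) (fun k => by ring)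
        (fun k => by simp only [weightB]; field_simp; ring)
      have vA : weightA α β (-β⁻¹) = 0 := by simp only [weightA]; field_simp; ring
      have vA' : weightA α β β⁻¹ = 0 := by simp only [weightA]; field_simp; ring
      have vB : weightB α β (-β⁻¹) = 0 := by simp only [weightB]; field_simp; ring
      have vC : weightB α (-β) β⁻¹ = 0 := by simp only [weightB]; field_simp; ring
      have uB : weightB α β β⁻¹ = 4 * (β - α) / β := by
        simp only [weightB]; field_simp; ring
      have uC : weightB α (-β) (-β⁻¹) = 4 * (β + α) / β := by
        simp only [weightB]; field_simp; ring
      simp only [signSum, hB, hC, vA, vA', vB, vC, uB, uC]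
      ring
    · intro p hp
      rw [hPe]
      obtain ⟨L', hL'⟩ : ∃ L', L.Perm (p :: L') := ⟨_, List.perm_cons_erase hp⟩
      have hm : ∀ q ∈ L', q ∈ L := fun q hq => hL'.mem_iff.2 (by simp [hq])
      have := ih L'.length (by have := hL'.length_eq; simp at this; omega) L'
        (fun q hq => hpos.2 q (hm q hq)) (fun q hq => hLα.2 q (hm q hq))
        (fun q hq => hLβ.2 q (hm q hq)) rfl
      simp only [signSum_perm (hL'.cons p), signSum_cons_cons_self]
      simp only [weightA, weightB] at this ⊢
      linear_combination
        (8 * p ^ 2 * ((1 - α ^ 2 * p ^ 2) * (1 - β ^ 2 * p ^ 2) ^ 2) *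
          (L'.map fun q => (q ^ 2 - p ^ 2) ^ 2).prod) * this
  rw [← hPe z, hP0, Polynomial.eval_zero]

/-- The function of an additional spectral parameter `z` whose evenness expresses the bilinear
equation coupling the two flows. -/
def flowSum (α β : ℝ) (L : List ℝ) (z : ℝ) : ℝ :=
  (2 * α ^ 2 * β ^ 2 * z ^ 2 - 2 * (2 * β ^ 2 - α ^ 2)) * (1 + α * z) *
      signSum L (fun k => weightA α β k * (k - z) ^ 2) +
    α * (α + β) * ((1 - α * z) * (1 + β * z) ^ 2) *
      signSum L (fun k => weightB α β k * (k - z) ^ 2) +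
    α * (α - β) * ((1 - α * z) * (1 - β * z) ^ 2) *
      signSum L (fun k => weightB α (-β) k * (k - z) ^ 2)

lemma flowSum_perm (α β : ℝ) {L L' : List ℝ} (h : L.Perm L') (z : ℝ) :
    flowSum α β L z = flowSum α β L' z := by
  simp only [flowSum, signSum_perm h]

lemma flowSum_cons_cons_self (α β p : ℝ) (L : List ℝ) (z : ℝ) :
    flowSum α β (p :: p :: L) z =
      8 * p ^ 2 * ((1 - α ^ 2 * p ^ 2) * (1 - β ^ 2 * p ^ 2) ^ 2 * (p ^ 2 - z ^ 2) ^ 2) *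
        (L.map fun q => (q ^ 2 - p ^ 2) ^ 2).prod * flowSum α β L z := by
  simp only [flowSum, signSum_cons_cons_self]
  simp only [weightA, weightB]
  ring

lemma flowSum_cons_self (α β p : ℝ) (L : List ℝ) :
    flowSum α β (p :: L) p = flowSum α β (p :: L) (-p) := by
  simp only [flowSum, signSum_cons_mul_sub_sq, sub_neg_eq_add, signSum_cons_mul_add_sq]
  simp only [weightA, weightB]
  ring

lemma flowSum_even (α β : ℝ) (hα : α ≠ 0) (hβ : β ≠ 0) (L : List ℝ)
    (hpos : ∀ p ∈ L, 0 < p) (hLα : ∀ p ∈ L, p * α ≠ 1 ∧ p * α ≠ -1)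
    (hLβ : ∀ p ∈ L, p * β ≠ 1 ∧ p * β ≠ -1) (z : ℝ) :
    flowSum α β L z = flowSum α β L (-z) := by
  by_cases hαβ : α ^ 2 = β ^ 2
  · rcases sq_eq_sq_iff_eq_or_eq_neg.1 hαβ with rfl | rfl
    · have : weightA α α = weightB α α := by funext k; simp only [weightA, weightB]; ring
      simp only [flowSum, this]; ring
    · have : weightA (-β) β = weightB (-β) (-β) := by
        funext k; simp only [weightA, weightB]; ring
      simp only [flowSum, this]; ring
  induction hn : L.length using Nat.strong_induction_on generalizing L with
  | _ n ih =>
  by_cases hL : L.Nodup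
  swap
  · obtain ⟨p, L', hp⟩ := List.exists_perm_cons_cons_of_not_nodup hL
    have hm : ∀ q ∈ L', q ∈ L := fun q hq => hp.mem_iff.2 (by simp [hq])
    have := ih L'.length (by have := hp.length_eq; simp at this; omega) L'
      (fun q hq => hpos q (hm q hq)) (fun q hq => hLα q (hm q hq))
      (fun q hq => hLβ q (hm q hq)) rfl
    simp only [flowSum_perm α β hp, flowSum_cons_cons_self, this, neg_sq]
  have hE := signSum_discreteKdV α β hα hβ L hpos hLα hLβ
  obtain ⟨PA, hA, hAe⟩ := exists_polynomial_mul_signSum L (weightA α β)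
    ((.C (2 * α ^ 2 * β ^ 2) * .X ^ 2 - .C (2 * (2 * β ^ 2 - α ^ 2))) * (1 + .C α * .X))
    (by compute_degree)
  obtain ⟨PB, hB, hBe⟩ := exists_polynomial_mul_signSum L (weightB α β)
    (.C (α * (α + β)) * ((1 - .C α * .X) * (1 + .C β * .X) ^ 2)) (by compute_degree)
  obtain ⟨PC, hC, hCe⟩ := exists_polynomial_mul_signSum L (weightB α (-β))
    (.C (α * (α - β)) * ((1 - .C α * .X) * (1 - .C β * .X) ^ 2)) (by compute_degree)
  let P : Polynomial ℝ := PA + PB + PC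
  have hdP : P.natDegree ≤ 2 * L.length + 3 :=
    Polynomial.natDegree_add_le_of_degree_le
      (Polynomial.natDegree_add_le_of_degree_le hA hB) hC
  have hPe : ∀ z, (P - P.comp (-.X)).eval z = flowSum α β L z - flowSum α β L (-z) := by
    intro z
    simp only [P, Polynomial.eval_add, Polynomial.eval_sub, Polynomial.eval_mul,
      Polynomial.eval_comp, Polynomial.eval_C, Polynomial.eval_neg, Polynomial.eval_X, hAe, hBe,
      hCe, flowSum, Polynomial.eval_one, Polynomial.eval_pow]
  have hP0 : P - P.comp (-.X) = 0 := by
    refine Polynomial.eq_zero_of_soliton_roots _ L α β hα hβ hαβ hL hpos hLα hLβ ?_ ?_ ?_ ?_ ?_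
    · refine (Polynomial.natDegree_sub_le_iff_left ?_).2 hdP
      rw [Polynomial.natDegree_comp]
      simpa using hdP
    · intro z hz
      rw [hPe] at hz ⊢
      rw [neg_neg]
      linarith
    · rw [hPe]
      have hA := signSum_of_eq_even_mul_neg L (fun k => weightA α β k * (k - α⁻¹) ^ 2)
        (fun k => (1 - α ^ 2 * k ^ 2) / α ^ 2) (weightA α β) (fun k => by ring)
        (fun k => by simp only [weightA]; field_simp; ring)
      have hB := signSum_of_eq_even_mul_neg L (fun k => weightB α β k * (k + α⁻¹) ^ 2)
        (fun k => (1 - α ^ 2 * k ^ 2) / α ^ 2) (weightB α (-β)) (fun k => by ring)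
        (fun k => by simp only [weightB]; field_simp; ring)
      have hC := signSum_of_eq_even_mul_neg L (fun k => weightB α (-β) k * (k + α⁻¹) ^ 2)
        (fun k => (1 - α ^ 2 * k ^ 2) / α ^ 2) (weightB α β) (fun k => by ring)
        (fun k => by simp only [weightB]; field_simp; ring)
      simp only [flowSum, sub_neg_eq_add, hA, hB, hC, mul_neg, mul_inv_cancel₀ hα]
      field_simp
      linear_combination (2 * (α ^ 2 - β ^ 2) *
        (L.map fun k => (1 - α ^ 2 * k ^ 2) / α ^ 2).prod) * hE
    · rw [hPe]
      have hA := signSum_of_eq_even_mul_neg L (fun k => weightA α β k * (k - β⁻¹) ^ 2)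
        (fun k => (1 - β ^ 2 * k ^ 2) / β ^ 2) (weightB α β) (fun k => by ring)
        (fun k => by simp only [weightA, weightB]; field_simp; ring)
      have hA' := signSum_of_eq_even_mul_neg L (fun k => weightA α β k * (k + β⁻¹) ^ 2)
        (fun k => (1 - β ^ 2 * k ^ 2) / β ^ 2) (weightB α (-β)) (fun k => by ring)
        (fun k => by simp only [weightA, weightB]; field_simp; ring)
      have hB := signSum_of_eq_even_mul_neg L (fun k => weightB α β k * (k - β⁻¹) ^ 2)
        (fun k => (1 - β ^ 2 * k ^ 2) / β ^ 2) (weightA α β) (fun k => by ring)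
        (fun k => by simp only [weightA, weightB]; field_simp; ring)
      have hC := signSum_of_eq_even_mul_neg L (fun k => weightB α (-β) k * (k + β⁻¹) ^ 2)
        (fun k => (1 - β ^ 2 * k ^ 2) / β ^ 2) (weightA α β) (fun k => by ring)
        (fun k => by simp only [weightA, weightB]; field_simp; ring)
      simp only [flowSum, sub_neg_eq_add, hA, hA', hB, hC, mul_neg, mul_inv_cancel₀ hβ]
      field_simp
      linear_combination (-4 * (α ^ 2 - β ^ 2) *
        (L.map fun k => (1 - β ^ 2 * k ^ 2) / β ^ 2).prod) * hE
    · intro p hp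
      rw [hPe, flowSum_perm α β (List.perm_cons_erase hp),
        flowSum_perm α β (List.perm_cons_erase hp), flowSum_cons_self, sub_self]
  have := hPe z
  rw [hP0, Polynomial.eval_zero] at this
  linarith

section Expansion

variable {ι : Type*}

/-- The sum over all ways to distribute the solitons of a list among two tau functions with
amplitudes `f` and `g`. -/
def splitSum (A : ι → ι → ℝ) : List ι → (ι → ℝ) → (ι → ℝ) → ℝ
  | [], _, _ => 1
  | m :: M, f, g =>
      f m * splitSum A M (fun j => f j * A m j) g + g m * splitSum A M f (fun j => g j * A m j)

lemma splitSum_mul (A : ι → ι → ℝ) (M : List ι) (h f g : ι → ℝ) :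
    splitSum A M (fun j => f j * h j) (fun j => g j * h j) =
      (M.map h).prod * splitSum A M f g := by
  induction M generalizing f g with
  | nil => simp [splitSum]
  | cons m M ih =>
    have h1 := ih (fun j => f j * A m j) g
    have h2 := ih f (fun j => g j * A m j)
    simp only [splitSum, List.map_cons, List.prod_cons]
    simp only [mul_right_comm _ (A m _) (h _)] at h1 h2
    rw [h1, h2]
    ring

/-- The soliton interaction coefficient `((pᵢ - pⱼ) / (pᵢ + pⱼ))²`. -/
def interaction (p : ι → ℝ) (i j : ι) : ℝ := ((p i - p j) / (p i + p j)) ^ 2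

lemma interaction_comm (p : ι → ℝ) (i j : ι) : interaction p i j = interaction p j i := by
  rw [interaction, interaction, ← neg_sub, neg_div, neg_sq, add_comm]

lemma mul_interaction (p : ι → ℝ) (m j : ι) (b v : ℝ) :
    b * v * interaction p m j = b / (p m + p j) ^ 2 * (v * (p j - p m) ^ 2) := by
  rw [interaction, div_pow]
  ring

lemma mul_eq_div_sq_mul (p : ι → ℝ) (hp : ∀ j, 0 < p j) (m j : ι) (b v : ℝ) :
    b * v = b / (p m + p j) ^ 2 * (v * (p j + p m) ^ 2) := by
  have := add_pos (hp m) (hp j)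
  field_simp
  ring

lemma splitSum_interaction_left (p : ι → ℝ) (hp : ∀ j, 0 < p j) (m : ι) (M : List ι)
    (b : ι → ℝ) (K : ℝ)
    (hK : ∀ w : ℝ → ℝ, splitSum (interaction p) M (fun j => b j / (p m + p j) ^ 2 * w (p j))
      (fun j => b j / (p m + p j) ^ 2 * w (-p j)) = K * signSum (M.map p) w) (w : ℝ → ℝ) :
    splitSum (interaction p) M (fun j => b j * w (p j) * interaction p m j)
        (fun j => b j * w (-p j)) =
      K * signSum (M.map p) (fun k => w k * (k - p m) ^ 2) := by
  rw [← hK fun k => w k * (k - p m) ^ 2]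
  congr 1 <;> funext j
  · exact mul_interaction p m j _ _
  · rw [mul_eq_div_sq_mul p hp m j]
    ring

lemma splitSum_interaction_right (p : ι → ℝ) (hp : ∀ j, 0 < p j) (m : ι) (M : List ι)
    (b : ι → ℝ) (K : ℝ)
    (hK : ∀ w : ℝ → ℝ, splitSum (interaction p) M (fun j => b j / (p m + p j) ^ 2 * w (p j))
      (fun j => b j / (p m + p j) ^ 2 * w (-p j)) = K * signSum (M.map p) w) (w : ℝ → ℝ) :
    splitSum (interaction p) M (fun j => b j * w (p j))
        (fun j => b j * w (-p j) * interaction p m j) =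
      K * signSum (M.map p) (fun k => w k * (k + p m) ^ 2) := by
  rw [← hK fun k => w k * (k + p m) ^ 2]
  congr 1 <;> funext j
  · exact mul_eq_div_sq_mul p hp m j _ _
  · rw [mul_interaction p m j]
    ring

lemma exists_splitSum_eq_mul_signSum (p : ι → ℝ) (hp : ∀ j, 0 < p j) (M : List ι) (b : ι → ℝ) :
    ∃ K : ℝ, ∀ w : ℝ → ℝ, splitSum (interaction p) M (fun j => b j * w (p j))
      (fun j => b j * w (-p j)) = K * signSum (M.map p) w := by
  induction M generalizing b with
  | nil => exact ⟨1, fun w => by simp [splitSum, signSum]⟩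
  | cons m M ih =>
    obtain ⟨K, hK⟩ := ih (fun j => b j / (p m + p j) ^ 2)
    refine ⟨b m * K, fun w => ?_⟩
    rw [splitSum, splitSum_interaction_left p hp m M b K hK,
      splitSum_interaction_right p hp m M b K hK, List.map_cons, signSum]
    ring

variable [LinearOrder ι]

/-- The interaction coefficient of a set of solitons. -/
def pairCoef (A : ι → ι → ℝ) (S : Finset ι) : ℝ :=
  ∏ i ∈ S, ∏ j ∈ S.filter (fun j => i < j), A i j

/-- The tau function of the solitons in `s` with amplitudes `f`. -/
def tauOn (A : ι → ι → ℝ) (s : Finset ι) (f : ι → ℝ) : ℝ :=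
  ∑ S ∈ s.powerset, pairCoef A S * ∏ j ∈ S, f j

lemma pairCoef_insert (A : ι → ι → ℝ) (hA : ∀ i j, A i j = A j i) {m : ι} {S : Finset ι}
    (hm : m ∉ S) : pairCoef A (insert m S) = pairCoef A S * ∏ j ∈ S, A m j := by
  have h1 : ∀ i ∈ S, (∏ j ∈ (insert m S).filter (fun j => i < j), A i j) =
      (∏ j ∈ S.filter (fun j => i < j), A i j) * if i < m then A m i else 1 := by
    intro i _
    rw [Finset.filter_insert]
    split_ifs with h
    · rw [Finset.prod_insert (by simp [hm]), hA i m, mul_comm]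
    · rw [mul_one]
  rw [pairCoef, Finset.prod_insert hm, Finset.prod_congr rfl h1, Finset.prod_mul_distrib,
    Finset.filter_insert, if_neg (lt_irrefl m), Finset.prod_filter, mul_left_comm,
    ← Finset.prod_mul_distrib, pairCoef]
  congr 1
  refine Finset.prod_congr rfl fun j hj => ?_
  rcases lt_trichotomy m j with h | h | h
  · simp [h, h.not_gt]
  · exact absurd (h ▸ hj) hm
  · simp [h, h.not_gt]

lemma pairCoef_insert_mul_prod (A : ι → ι → ℝ) (hA : ∀ i j, A i j = A j i) {m : ι}
    {S : Finset ι} (hm : m ∉ S) (f : ι → ℝ) :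
    pairCoef A (insert m S) * ∏ j ∈ insert m S, f j =
      f m * (pairCoef A S * ∏ j ∈ S, (f j * A m j)) := by
  rw [pairCoef_insert A hA hm, Finset.prod_insert hm, Finset.prod_mul_distrib]
  ring

lemma tauOn_insert (A : ι → ι → ℝ) (hA : ∀ i j, A i j = A j i) {m : ι} {s : Finset ι}
    (hm : m ∉ s) (f : ι → ℝ) :
    tauOn A (insert m s) f = tauOn A s f + f m * tauOn A s (fun j => f j * A m j) := by
  rw [tauOn, Finset.sum_powerset_insert hm, tauOn, tauOn, Finset.mul_sum]
  congr 1
  refine Finset.sum_congr rfl fun S hS => ?_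
  exact pairCoef_insert_mul_prod A hA (fun h => hm (Finset.mem_powerset.1 hS h)) f

lemma sum_mul_tauOn_mul_tauOn_eq_zero (A : ι → ι → ℝ) (hA : ∀ i j, A i j = A j i)
    (s : Finset ι) {κ : Type*} [Fintype κ] (c : κ → ℝ) (f g : κ → ι → ℝ) (e : ι → ℝ)
    (he : ∀ t j, f t j * g t j = e j)
    (h : ∀ M : List ι, ∑ t, c t * splitSum A M (f t) (g t) = 0) :
    ∑ t, c t * (tauOn A s (f t) * tauOn A s (g t)) = 0 := by
  induction s using Finset.induction_on generalizing κ e with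
  | empty => simpa [tauOn, pairCoef, splitSum] using h []
  | insert m s hm ih =>
    have h0 := ih c f g e he h
    have h1 := ih c (fun t j => f t j * A m j) (fun t j => g t j * A m j)
      (fun j => e j * A m j ^ 2) (fun t j => by rw [← he t j]; ring) (fun M => by
        simp only [splitSum_mul, mul_left_comm (c _)]
        rw [← Finset.mul_sum, h M, mul_zero])
    have h2 := ih (κ := κ ⊕ κ) (Sum.elim (fun t => c t * f t m) (fun t => c t * g t m))
      (Sum.elim (fun t j => f t j * A m j) f) (Sum.elim g (fun t j => g t j * A m j))
      (fun j => e j * A m j)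
      (by rintro (t | t) j <;> simp only [Sum.elim_inl, Sum.elim_inr, ← he t j] <;> ring)
      (fun M => by
        rw [← h (m :: M)]
        simp only [Fintype.sum_sum_type, Sum.elim_inl, Sum.elim_inr, splitSum]
        rw [← Finset.sum_add_distrib]
        exact Finset.sum_congr rfl fun t _ => by ring)
    simp only [Fintype.sum_sum_type, Sum.elim_inl, Sum.elim_inr] at h2
    rw [← Finset.sum_add_distrib] at h2
    calc _ = ∑ t, c t * (tauOn A s (f t) * tauOn A s (g t)) +
          e m * ∑ t, c t * (tauOn A s (fun j => f t j * A m j) *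
            tauOn A s (fun j => g t j * A m j)) +
          ∑ t, (c t * f t m * (tauOn A s (fun j => f t j * A m j) * tauOn A s (g t)) +
            c t * g t m * (tauOn A s (f t) * tauOn A s (fun j => g t j * A m j))) := by
          rw [Finset.mul_sum, ← Finset.sum_add_distrib, ← Finset.sum_add_distrib]
          refine Finset.sum_congr rfl fun t _ => ?_
          rw [tauOn_insert A hA hm, tauOn_insert A hA hm, ← he t m]
          ring
      _ = 0 := by rw [h0, h1, h2]; ring

variable [Fintype ι]

/-- The contribution of the amplitude of the soliton `m` to the Hirota derivative of two tau
functions. -/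
def hirotaTerm (A : ι → ι → ℝ) (m : ι) (f g : ι → ℝ) : ℝ :=
  f m * (tauOn A (Finset.univ.erase m) (fun j => f j * A m j) * tauOn A (Finset.univ.erase m) g) -
    g m * (tauOn A (Finset.univ.erase m) f * tauOn A (Finset.univ.erase m) (fun j => g j * A m j))

lemma sum_mul_hirotaTerm_eq_zero (p : ι → ℝ) (hp : ∀ j, 0 < p j) (m : ι) {κ : Type*}
    [Fintype κ] (c : κ → ℝ) (w : κ → ℝ → ℝ) (b : ι → ℝ) (e : ℝ → ℝ)
    (he : ∀ t k, w t k * w t (-k) = e k)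
    (h : ∀ M : List ι, ∑ t, c t *
      (w t (p m) * signSum (M.map p) (fun k => w t k * (k - p m) ^ 2) -
        w t (-p m) * signSum (M.map p) (fun k => w t k * (k + p m) ^ 2)) = 0) :
    ∑ t, c t * hirotaTerm (interaction p) m (fun j => b j * w t (p j))
      (fun j => b j * w t (-p j)) = 0 := by
  have key := sum_mul_tauOn_mul_tauOn_eq_zero (interaction p) (interaction_comm p)
    (Finset.univ.erase m) (κ := κ ⊕ κ)
    (Sum.elim (fun t => c t * (b m * w t (p m))) (fun t => -(c t * (b m * w t (-p m)))))
    (Sum.elim (fun t j => b j * w t (p j) * interaction p m j) (fun t j => b j * w t (p j)))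
    (Sum.elim (fun t j => b j * w t (-p j)) (fun t j => b j * w t (-p j) * interaction p m j))
    (fun j => b j ^ 2 * e (p j) * interaction p m j)
    (by rintro (t | t) j <;> simp only [Sum.elim_inl, Sum.elim_inr, ← he t (p j)] <;> ring)
    (fun M => by
      obtain ⟨K, hK⟩ := exists_splitSum_eq_mul_signSum p hp M (fun j => b j / (p m + p j) ^ 2)
      have hM := congrArg (fun x => b m * K * x) (h M)
      simp only [mul_zero, Finset.mul_sum] at hM
      simp only [Fintype.sum_sum_type, Sum.elim_inl, Sum.elim_inr,
        splitSum_interaction_left p hp m M b K hK,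
        splitSum_interaction_right p hp m M b K hK]
      rw [← hM, ← Finset.sum_add_distrib]
      exact Finset.sum_congr rfl fun t _ => by ring)
  simp only [Fintype.sum_sum_type, Sum.elim_inl, Sum.elim_inr] at key
  rw [← key, ← Finset.sum_add_distrib]
  exact Finset.sum_congr rfl fun t _ => by rw [hirotaTerm]; ring

lemma tauOn_univ_eq_add (A : ι → ι → ℝ) (hA : ∀ i j, A i j = A j i) (m : ι) (f : ι → ℝ) :
    tauOn A Finset.univ f = tauOn A (Finset.univ.erase m) f +
      f m * tauOn A (Finset.univ.erase m) (fun j => f j * A m j) := by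
  rw [← tauOn_insert A hA (Finset.notMem_erase m _), Finset.insert_erase (Finset.mem_univ m)]

lemma sum_ite_mem_pairCoef (A : ι → ι → ℝ) (hA : ∀ i j, A i j = A j i) (m : ι) (f : ι → ℝ) :
    ∑ S : Finset ι, (if m ∈ S then pairCoef A S * ∏ j ∈ S, f j else 0) =
      f m * tauOn A (Finset.univ.erase m) (fun j => f j * A m j) := by
  have hm := Finset.notMem_erase m (Finset.univ : Finset ι)
  rw [← Finset.powerset_univ, ← Finset.insert_erase (Finset.mem_univ m),
    Finset.sum_powerset_insert hm, Finset.insert_erase (Finset.mem_univ m), tauOn,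
    Finset.mul_sum]
  have hS : ∀ S ∈ (Finset.univ.erase m).powerset, m ∉ S :=
    fun S hS h => hm (Finset.mem_powerset.1 hS h)
  rw [Finset.sum_eq_zero fun S h => if_neg (hS S h), zero_add]
  refine Finset.sum_congr rfl fun S h => ?_
  rw [if_pos (Finset.mem_insert_self m S), pairCoef_insert_mul_prod A hA (hS S h)]

lemma hasDerivAt_tauOn_univ (A : ι → ι → ℝ) (hA : ∀ i j, A i j = A j i) (φ : ι → ℝ → ℝ)
    (ρ : ι → ℝ) (x : ℝ) (hφ : ∀ j, HasDerivAt (φ j) (ρ j * φ j x) x) :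
    HasDerivAt (fun s => tauOn A Finset.univ (fun j => φ j s))
      (∑ m, ρ m * (φ m x * tauOn A (Finset.univ.erase m) (fun j => φ j x * A m j))) x := by
  have h : HasDerivAt (fun s => ∑ S : Finset ι, pairCoef A S * ∏ j ∈ S, φ j s)
      (∑ S : Finset ι, pairCoef A S * ∑ m ∈ S, (∏ j ∈ S.erase m, φ j x) • (ρ m * φ m x)) x :=
    HasDerivAt.fun_sum fun S _ =>
      (HasDerivAt.fun_finsetProd fun j _ => hφ j).const_mul (pairCoef A S)
  simp only [tauOn, Finset.powerset_univ]
  convert h using 1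
  have h2 : ∀ S : Finset ι,
      pairCoef A S * ∑ m ∈ S, (∏ j ∈ S.erase m, φ j x) • (ρ m * φ m x) =
        ∑ m, ρ m * (if m ∈ S then pairCoef A S * ∏ j ∈ S, φ j x else 0) := by
    intro S
    simp only [mul_ite, mul_zero, Finset.sum_ite_mem, Finset.univ_inter, Finset.mul_sum]
    refine Finset.sum_congr rfl fun m hm => ?_
    rw [← Finset.mul_prod_erase S (fun j => φ j x) hm, smul_eq_mul]
    ring
  simp only [h2]
  rw [Finset.sum_comm]
  refine Finset.sum_congr rfl fun m _ => ?_
  rw [← Finset.mul_sum, sum_ite_mem_pairCoef A hA m (fun j => φ j x), tauOn]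

lemma hirota_tauOn_univ (A : ι → ι → ℝ) (hA : ∀ i j, A i j = A j i) (φ ψ : ι → ℝ → ℝ)
    (ρ : ι → ℝ) (x : ℝ) (hφ : ∀ j, HasDerivAt (φ j) (ρ j * φ j x) x)
    (hψ : ∀ j, HasDerivAt (ψ j) (ρ j * ψ j x) x) :
    deriv (fun s => tauOn A Finset.univ (fun j => φ j s)) x *
        tauOn A Finset.univ (fun j => ψ j x) -
      tauOn A Finset.univ (fun j => φ j x) *
        deriv (fun s => tauOn A Finset.univ (fun j => ψ j s)) x =
      ∑ m, ρ m * hirotaTerm A m (fun j => φ j x) (fun j => ψ j x) := by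
  rw [(hasDerivAt_tauOn_univ A hA φ ρ x hφ).deriv, (hasDerivAt_tauOn_univ A hA ψ ρ x hψ).deriv,
    Finset.sum_mul, Finset.mul_sum, ← Finset.sum_sub_distrib]
  refine Finset.sum_congr rfl fun m _ => ?_
  rw [tauOn_univ_eq_add A hA m (fun j => ψ j x), tauOn_univ_eq_add A hA m (fun j => φ j x),
    hirotaTerm]
  ring

end Expansion

lemma tauS_eq_tauOn {N : ℕ} (p a r : Fin N → ℝ) (α β : ℝ) (l k : ℤ) (y0 y2 : ℝ) :
    tauS p a r α β l k y0 y2 =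
      tauOn (interaction p) Finset.univ (fun j => phiS p a r α β j l k y0 y2) := by
  rw [tauOn, Finset.powerset_univ]
  rfl

lemma Dy0_tauS {N : ℕ} (p a r : Fin N → ℝ) (α β : ℝ) (l k l' k' : ℤ) (y0 y2 : ℝ) :
    Dy0 (tauS p a r α β l k) (tauS p a r α β l' k') y0 y2 =
      ∑ m, r m * hirotaTerm (interaction p) m (fun j => phiS p a r α β j l k y0 y2)
        (fun j => phiS p a r α β j l' k' y0 y2) := by
  have hd : ∀ l k j, HasDerivAt (fun s => phiS p a r α β j l k s y2)
      (r j * phiS p a r α β j l k y0 y2) y0 := by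
    intro l k j
    have h := ((((((hasDerivAt_id y0).const_mul (r j)).add_const
      (r j * p j ^ 2 * y2)).exp).const_mul (a j)).mul_const
        (((1 + p j * α) / (1 - p j * α)) ^ l)).mul_const (((1 + p j * β) / (1 - p j * β)) ^ k)
    refine h.congr_deriv ?_
    simp only [phiS, id]
    ring
  simp only [Dy0, tauS_eq_tauOn]
  exact hirota_tauOn_univ (interaction p) (interaction_comm p)
    (fun j s => phiS p a r α β j l k s y2) (fun j s => phiS p a r α β j l' k' s y2) r y0
    (hd l k) (hd l' k')

lemma Dy2_tauS {N : ℕ} (p a r : Fin N → ℝ) (α β : ℝ) (l k l' k' : ℤ) (y0 y2 : ℝ) :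
    Dy2 (tauS p a r α β l k) (tauS p a r α β l' k') y0 y2 =
      ∑ m, r m * p m ^ 2 * hirotaTerm (interaction p) m
        (fun j => phiS p a r α β j l k y0 y2) (fun j => phiS p a r α β j l' k' y0 y2) := by
  have hd : ∀ l k j, HasDerivAt (fun s => phiS p a r α β j l k y0 s)
      (r j * p j ^ 2 * phiS p a r α β j l k y0 y2) y2 := by
    intro l k j
    have h := ((((((hasDerivAt_id y2).const_mul (r j * p j ^ 2)).const_add
      (r j * y0)).exp).const_mul (a j)).mul_const
        (((1 + p j * α) / (1 - p j * α)) ^ l)).mul_const (((1 + p j * β) / (1 - p j * β)) ^ k)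
    refine h.congr_deriv ?_
    simp only [phiS, id]
    ring
  simp only [Dy2, tauS_eq_tauOn]
  exact hirota_tauOn_univ (interaction p) (interaction_comm p)
    (fun j s => phiS p a r α β j l k y0 s) (fun j s => phiS p a r α β j l' k' y0 s)
    (fun j => r j * p j ^ 2) y2 (hd l k) (hd l' k')

lemma phiS_eq_mul_weight {N : ℕ} (p a r : Fin N → ℝ) (α β : ℝ) (j : Fin N) (l k : ℤ)
    (y0 y2 : ℝ) (hα : p j * α ≠ 1 ∧ p j * α ≠ -1) (hβ : p j * β ≠ 1 ∧ p j * β ≠ -1) (b : ℝ)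
    (hb : b = phiS p a r α β j l k y0 y2 / ((1 - p j * α) * (1 - p j * β) * (1 + p j * β))) :
    phiS p a r α β j (l + 1) k y0 y2 = b * weightA α β (p j) ∧
    phiS p a r α β j l k y0 y2 = b * weightA α β (-p j) ∧
    phiS p a r α β j l (k + 1) y0 y2 = b * weightB α β (p j) ∧
    phiS p a r α β j (l + 1) (k - 1) y0 y2 = b * weightB α β (-p j) ∧
    phiS p a r α β j l (k - 1) y0 y2 = b * weightB α (-β) (p j) ∧
    phiS p a r α β j (l + 1) (k + 1) y0 y2 = b * weightB α (-β) (-p j) := by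
  have h1 : 1 - p j * α ≠ 0 := fun h => hα.1 (by linarith)
  have h2 : 1 + p j * α ≠ 0 := fun h => hα.2 (by linarith)
  have h3 : 1 - p j * β ≠ 0 := fun h => hβ.1 (by linarith)
  have h4 : 1 + p j * β ≠ 0 := fun h => hβ.2 (by linarith)
  have hx : (1 + p j * α) / (1 - p j * α) ≠ 0 := div_ne_zero h2 h1
  have hy : (1 + p j * β) / (1 - p j * β) ≠ 0 := div_ne_zero h4 h3
  subst hb
  simp only [phiS, weightA, weightB, zpow_add_one₀ hx, zpow_add_one₀ hy, zpow_sub_one₀ hy,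
    inv_div]
  generalize ((1 + p j * α) / (1 - p j * α)) ^ l = X
  generalize ((1 + p j * β) / (1 - p j * β)) ^ k = Y
  refine ⟨?_, ?_, ?_, ?_, ?_, ?_⟩ <;> field_simp <;> ring

/-- the semi-discrete `N`-soliton tau function satisfies the bilinear
differential-difference equation coupling the `y₀`- and `y₂`-flows. -/
theorem tauS_satisfies_bilinear_diffdiff (N : ℕ) (p a r : Fin N → ℝ) (α β : ℝ)
    (hp : ∀ j, 0 < p j) (hα : α ≠ 0) (hβ : β ≠ 0)
    (hpα : ∀ j, p j * α ≠ 1 ∧ p j * α ≠ -1)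
    (hpβ : ∀ j, p j * β ≠ 1 ∧ p j * β ≠ -1) :
    ∀ (l k : ℤ) (y0 y2 : ℝ),
      α * β ^ 2 *
        (2 * α * Dy2 (tauS p a r α β (l + 1) k) (tauS p a r α β l k) y0 y2 -
          (α + β) * Dy2 (tauS p a r α β l (k + 1)) (tauS p a r α β (l + 1) (k - 1)) y0 y2 -
          (α - β) * Dy2 (tauS p a r α β l (k - 1)) (tauS p a r α β (l + 1) (k + 1)) y0 y2)
      = 2 * (2 * β ^ 2 - α ^ 2) * Dy0 (tauS p a r α β (l + 1) k) (tauS p a r α β l k) y0 y2 -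
          α * (α + β) * Dy0 (tauS p a r α β l (k + 1)) (tauS p a r α β (l + 1) (k - 1)) y0 y2 -
          α * (α - β) * Dy0 (tauS p a r α β l (k - 1)) (tauS p a r α β (l + 1) (k + 1)) y0 y2 := by
  intro l k y0 y2
  let b : Fin N → ℝ := fun j =>
    phiS p a r α β j l k y0 y2 / ((1 - p j * α) * (1 - p j * β) * (1 + p j * β))
  have hφ := fun j => phiS_eq_mul_weight p a r α β j l k y0 y2 (hpα j) (hpβ j) (b j) rfl
  have key : ∀ m, (2 * α ^ 2 * β ^ 2 * p m ^ 2 - 2 * (2 * β ^ 2 - α ^ 2)) *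
        hirotaTerm (interaction p) m (fun j => phiS p a r α β j (l + 1) k y0 y2)
          (fun j => phiS p a r α β j l k y0 y2) +
      α * (α + β) * (1 - β ^ 2 * p m ^ 2) *
        hirotaTerm (interaction p) m (fun j => phiS p a r α β j l (k + 1) y0 y2)
          (fun j => phiS p a r α β j (l + 1) (k - 1) y0 y2) +
      α * (α - β) * (1 - β ^ 2 * p m ^ 2) *
        hirotaTerm (interaction p) m (fun j => phiS p a r α β j l (k - 1) y0 y2)
          (fun j => phiS p a r α β j (l + 1) (k + 1) y0 y2) = 0 := by
    intro m
    have h := sum_mul_hirotaTerm_eq_zero p hp m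
      ![2 * α ^ 2 * β ^ 2 * p m ^ 2 - 2 * (2 * β ^ 2 - α ^ 2),
        α * (α + β) * (1 - β ^ 2 * p m ^ 2), α * (α - β) * (1 - β ^ 2 * p m ^ 2)]
      ![weightA α β, weightB α β, weightB α (-β)] b
      (fun k => (1 - α ^ 2 * k ^ 2) * (1 - β ^ 2 * k ^ 2) ^ 2)
      (fun t k => by fin_cases t <;> simp [weightA, weightB] <;> ring)
      (fun M => by
        have hf := flowSum_even α β hα hβ (M.map p) (by simpa using fun j _ => hp j)
          (by simpa using fun j _ => hpα j) (by simpa using fun j _ => hpβ j) (p m)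
        simp only [flowSum, sub_neg_eq_add] at hf
        simp only [Fin.sum_univ_three, Matrix.cons_val]
        generalize signSum (M.map p) (fun k => weightA α β k * (k - p m) ^ 2) = s1 at *
        generalize signSum (M.map p) (fun k => weightA α β k * (k + p m) ^ 2) = s2 at *
        generalize signSum (M.map p) (fun k => weightB α β k * (k - p m) ^ 2) = s3 at *
        generalize signSum (M.map p) (fun k => weightB α β k * (k + p m) ^ 2) = s4 at *
        generalize signSum (M.map p) (fun k => weightB α (-β) k * (k - p m) ^ 2) = s5 at *
        generalize signSum (M.map p) (fun k => weightB α (-β) k * (k + p m) ^ 2) = s6 at *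
        simp only [weightA, weightB]
        linear_combination (1 - β ^ 2 * p m ^ 2) * hf)
    simp only [Fin.sum_univ_three, Matrix.cons_val] at h
    rw [funext fun j => (hφ j).1, funext fun j => (hφ j).2.1, funext fun j => (hφ j).2.2.1,
      funext fun j => (hφ j).2.2.2.1, funext fun j => (hφ j).2.2.2.2.1,
      funext fun j => (hφ j).2.2.2.2.2]
    exact h
  simp only [Dy0_tauS, Dy2_tauS]
  rw [← sub_eq_zero]
  simp only [mul_sub, Finset.mul_sum, ← Finset.sum_sub_distrib]
  refine Finset.sum_eq_zero fun m _ => ?_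
  linear_combination r m * key m
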